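/- arXiv:1705.02497 — 5 statements merged into one kernel-verified Lean document; each statement's English description precedes it below -/
import Mathlib

section
/- Let $a \geq 1$ and $m \geq 1$ be integers, and let $f_0(n) = \binom{a}{n-1}$. Then for all integers $n \geq k \geq 1$, $c_m(n,k) = \sum_{i=k}^{n} (m-1)^{i-k} \binom{i-1}{k-1} \binom{ia}{n-i}$. -/
/-- `c1 f0 n k` : the sum over all compositions `i₁ + ⋯ + i_k = n` of `n` into `k`
positive parts of the products `f0 i₁ ⋯ f0 i_k`. -/
def c1 (f0 : ℕ → ℕ) (n k : ℕ) : ℕ :=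
  ∑ x ∈ (Finset.Nat.antidiagonalTuple k n).filter (fun x => ∀ t, 0 < x t),
    ∏ t, f0 (x t)

/-- `fm f0 m` is the `m`-th invert transform of `f0`:
`f_0 = f0` and `f_m (n) = ∑_{k=1}^n c_m (n,k)` for `m ≥ 1`. -/
def fm (f0 : ℕ → ℕ) : ℕ → ℕ → ℕ
  | 0 => f0
  | m + 1 => fun n => ∑ k ∈ Finset.Icc 1 n, c1 (fm f0 m) n k

/-- `cm f0 m n k = c_m(n,k)` (for `m ≥ 1`), the sum over compositions of `n` into `k`
positive parts of products of values of `f_{m-1}`. -/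
def cm (f0 : ℕ → ℕ) (m : ℕ) : ℕ → ℕ → ℕ := c1 (fm f0 (m - 1))

open PowerSeries

/-- The ordinary generating function `∑_{n ≥ 1} f n X ^ n` with integer coefficients. -/
noncomputable def genFun (f : ℕ → ℕ) : PowerSeries ℤ :=
  mk fun n => if n = 0 then 0 else (f n : ℤ)

theorem constantCoeff_genFun (f : ℕ → ℕ) : constantCoeff (genFun f) = 0 := by
  simp [genFun, ← coeff_zero_eq_constantCoeff_apply]

theorem coeff_genFun_pow (f : ℕ → ℕ) (n k : ℕ) :
    coeff n (genFun f ^ k) = (c1 f n k : ℤ) := by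
  classical
  have h := coeff_prod (fun _ : Fin k => genFun f) n Finset.univ
  rw [Finset.prod_const, Finset.card_univ, Fintype.card_fin] at h
  rw [h, c1, Finset.sum_filter, Nat.cast_sum]
  refine Finset.sum_equiv Finsupp.equivFunOnFinite (fun l => ?_) (fun l _ => ?_)
  · simp [Finset.mem_finsuppAntidiag, Finset.Nat.mem_antidiagonalTuple]
  · simp only [genFun, coeff_mk, Finsupp.equivFunOnFinite_apply]
    split_ifs with hl
    · rw [Nat.cast_prod]
      exact Finset.prod_congr rfl fun i _ => if_neg (hl i).ne'
    · push Not at hl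
      obtain ⟨t, ht⟩ := hl
      rw [Nat.cast_zero]
      exact Finset.prod_eq_zero (Finset.mem_univ t) (if_pos (Nat.le_zero.mp ht))

theorem coeff_pow_eq_zero_of_lt {F : PowerSeries ℤ} (hF : constantCoeff F = 0) {n i : ℕ}
    (h : n < i) : coeff n (F ^ i) = 0 :=
  X_pow_dvd_iff.mp (pow_dvd_pow_of_dvd (X_dvd_iff.mpr hF) i) n h

theorem coeff_subst_eq_sum {F : PowerSeries ℤ} (hF : constantCoeff F = 0) (P : PowerSeries ℤ)
    (n : ℕ) : coeff n (P.subst F) =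
      ∑ i ∈ Finset.range (n + 1), coeff i P * coeff n (F ^ i) := by
  rw [coeff_subst' (HasSubst.of_constantCoeff_zero' hF)]
  refine (finsum_eq_sum_of_support_subset _ fun i hi => ?_).trans
    (Finset.sum_congr rfl fun _ _ => smul_eq_mul _ _)
  by_contra h
  simp only [Finset.coe_range, Set.mem_Iio, not_lt] at h
  exact hi (by simp [coeff_pow_eq_zero_of_lt hF (show n < i by omega)])

theorem genFun_fm_succ_mul (f : ℕ → ℕ) (m : ℕ) :
    genFun (fm f (m + 1)) * (1 - genFun (fm f m)) = genFun (fm f m) := by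
  have hF := constantCoeff_genFun (fm f m)
  have hs : HasSubst (genFun (fm f m)) := HasSubst.of_constantCoeff_zero' hF
  have h : genFun (fm f (m + 1)) = (X * mk 1 : PowerSeries ℤ).subst (genFun (fm f m)) := by
    ext n
    rw [coeff_subst_eq_sum hF, Finset.sum_range_succ', genFun, coeff_mk]
    rcases n with _ | n
    · simp
    · have hI : Finset.Icc 1 (n + 1) = Finset.Ico (0 + 1) (n + 1 + 1) := rfl
      rw [if_neg n.succ_ne_zero, fm]
      beta_reduce
      rw [hI, ← Finset.sum_Ico_add', ← Finset.range_eq_Ico]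
      simp [coeff_succ_X_mul, coeff_genFun_pow]
  have h1 : (1 - X : PowerSeries ℤ).subst (genFun (fm f m)) = 1 - genFun (fm f m) := by
    rw [← coe_substAlgHom hs, map_sub, map_one, coe_substAlgHom hs, subst_X hs]
  rw [h, ← h1, ← subst_mul hs, mul_assoc, mk_one_mul_one_sub_eq_one, mul_one, subst_X hs]

theorem one_sub_mul_ne_zero {F : PowerSeries ℤ} (hF : constantCoeff F = 0) (c : PowerSeries ℤ) :
    1 - c * F ≠ 0 := by
  intro h
  simpa [hF] using congrArg constantCoeff h

theorem genFun_fm_mul (f : ℕ → ℕ) (m : ℕ) :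
    genFun (fm f m) * (1 - (m : PowerSeries ℤ) * genFun f) = genFun f := by
  induction m with
  | zero => simp [fm]
  | succ m ih =>
    have h := genFun_fm_succ_mul f m
    push_cast
    linear_combination (1 - (m : PowerSeries ℤ) * genFun f) * h +
      (1 + genFun (fm f (m + 1))) * ih

theorem genFun_fm_pow_succ (f : ℕ → ℕ) (m k : ℕ) :
    genFun (fm f m) ^ (k + 1) =
      (X ^ (k + 1) * rescale (m : ℤ) (mk fun j => ((k + j).choose k : ℤ))).subst (genFun f) := by
  have hF := constantCoeff_genFun f
  have hs : HasSubst (genFun f) := HasSubst.of_constantCoeff_zero' hF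
  refine mul_right_cancel₀ (pow_ne_zero (k + 1) (one_sub_mul_ne_zero hF m)) ?_
  rw [← mul_pow, genFun_fm_mul]
  have h1 : (rescale (m : ℤ) (1 - X : PowerSeries ℤ)).subst (genFun f) =
      1 - (m : PowerSeries ℤ) * genFun f := by
    rw [map_sub, map_one, rescale_X, map_natCast, ← coe_substAlgHom hs, map_sub, map_one,
      map_mul, map_natCast, coe_substAlgHom hs, subst_X hs]
  rw [← h1, ← subst_pow hs, ← subst_mul hs, mul_assoc, ← map_pow, ← map_mul,
    mk_add_choose_mul_one_sub_pow_eq_one, map_one, mul_one, subst_pow hs, subst_X hs]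

theorem coeff_one_add_X_pow (N j : ℕ) :
    coeff j ((1 + X : PowerSeries ℤ) ^ N) = (N.choose j : ℤ) := by
  have := Polynomial.coeff_one_add_X_pow ℤ N j
  rw [← this, ← Polynomial.coeff_coe]
  simp

theorem genFun_choose (a : ℕ) :
    genFun (fun i => a.choose (i - 1)) = X * (1 + X) ^ a := by
  ext n
  rcases n with _ | n
  · simp [genFun]
  · simp [genFun, coeff_succ_X_mul, coeff_one_add_X_pow]

theorem stmt_1 (a m : ℕ) (ha : 1 ≤ a) (hm : 1 ≤ m) (n k : ℕ) (hk : 1 ≤ k) (hn : k ≤ n) :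
    cm (fun i => a.choose (i - 1)) m n k =
      ∑ i ∈ Finset.Icc k n, (m - 1) ^ (i - k) * (i - 1).choose (k - 1) * (i * a).choose (n - i) := by
  obtain ⟨m, rfl⟩ := Nat.exists_eq_add_of_le' hm
  obtain ⟨k, rfl⟩ := Nat.exists_eq_add_of_le' hk
  zify
  rw [cm, ← coeff_genFun_pow, Nat.add_sub_cancel, genFun_fm_pow_succ,
    coeff_subst_eq_sum (constantCoeff_genFun _), genFun_choose]
  symm
  refine Finset.sum_subset_zero_on_sdiff (fun i hi => ?_) (fun i hi => ?_) (fun i hi => ?_)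
  · simp only [Finset.mem_Icc, Finset.mem_range] at *
    omega
  · simp only [Finset.mem_sdiff, Finset.mem_Icc, Finset.mem_range] at hi
    rw [coeff_X_pow_mul', if_neg (by omega), zero_mul]
  · rw [Finset.mem_Icc] at hi
    rw [coeff_X_pow_mul', if_pos hi.1, coeff_rescale, coeff_mk, mul_pow, coeff_X_pow_mul',
      if_pos hi.2, ← pow_mul, coeff_one_add_X_pow, mul_comm a i,
      show k + (i - (k + 1)) = i - 1 by omega]
    simp
end

section
/- Let $a \geq 1$ and $m \geq 1$ be integers, and let $f_0(n) = \binom{n+a-2}{a-1}$. Then for all integers $n \geq k \geq 1$, $c_m(n,k) = \sum_{i=k}^{n} (m-1)^{i-k} \binom{i-1}{k-1} \binom{n+ai-i-1}{ai-1}$. -/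
open PowerSeries in
/-- The generating function `∑_{n ≥ 1} f n X ^ n`. -/
noncomputable def posGenFun (f : ℕ → ℕ) : ℤ⟦X⟧ :=
  PowerSeries.mk fun n => if n = 0 then 0 else (f n : ℤ)

open PowerSeries in
lemma constantCoeff_posGenFun (f : ℕ → ℕ) : constantCoeff (posGenFun f) = 0 := by
  simp [posGenFun, ← coeff_zero_eq_constantCoeff_apply]

open PowerSeries in
lemma coeff_eq_zero_of_constantCoeff_eq_zero_of_lt {R : Type*} [CommRing R] {F : R⟦X⟧}
    (hF : constantCoeff F = 0) {n i : ℕ} (h : n < i) : coeff n (F ^ i) = 0 :=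
  X_pow_dvd_iff.mp (pow_dvd_pow_of_dvd (X_dvd_iff.mpr hF) i) n h

open PowerSeries in
lemma coeff_posGenFun_pow (f : ℕ → ℕ) (n k : ℕ) :
    coeff n (posGenFun f ^ k) = (c1 f n k : ℤ) := by
  have hprod : posGenFun f ^ k = ∏ _t : Fin k, posGenFun f := by simp
  rw [hprod, coeff_prod, c1, Finset.sum_filter, Nat.cast_sum]
  refine Finset.sum_nbij' (fun l t => l t) (fun x => Finsupp.equivFunOnFinite.symm x)
    ?_ ?_ ?_ ?_ ?_
  · intro l hl
    simpa [Finset.Nat.mem_antidiagonalTuple, Finset.mem_finsuppAntidiag] using hl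
  · intro x hx
    simpa [Finset.Nat.mem_antidiagonalTuple, Finset.mem_finsuppAntidiag] using hx
  · intro l _
    ext t
    simp
  · intro x _
    ext t
    simp
  · intro l _
    split_ifs with h
    · rw [Nat.cast_prod]
      exact Finset.prod_congr rfl fun t _ => by simp [posGenFun, (h t).ne']
    · push Not at h
      obtain ⟨t, ht⟩ := h
      exact Finset.prod_eq_zero (Finset.mem_univ t) (by simp [posGenFun, Nat.le_zero.mp ht])

open PowerSeries in
lemma posGenFun_invert (f : ℕ → ℕ) :
    posGenFun (fun n => ∑ k ∈ Finset.Icc 1 n, c1 f n k) * (1 - posGenFun f) = posGenFun f := by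
  set F := posGenFun f with hF
  have hF0 : constantCoeff F = 0 := constantCoeff_posGenFun f
  ext n
  have hcoeff : ∀ j ≤ n, coeff j (posGenFun (fun n => ∑ k ∈ Finset.Icc 1 n, c1 f n k)) =
      coeff j (∑ k ∈ Finset.range n, F ^ (k + 1)) := by
    intro j hj
    rw [map_sum]
    simp only [posGenFun, coeff_mk]
    split_ifs with h
    · subst h
      exact (Finset.sum_eq_zero fun k _ =>
        coeff_eq_zero_of_constantCoeff_eq_zero_of_lt hF0 k.succ_pos).symm
    · rw [Nat.cast_sum, ← Finset.Ico_succ_right_eq_Icc, Finset.sum_Ico_eq_sum_range]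
      refine (Finset.sum_subset (s₂ := Finset.range n) (by simpa using hj)
        fun k _ hk => ?_).trans ?_
      · rw [← coeff_posGenFun_pow]
        refine coeff_eq_zero_of_constantCoeff_eq_zero_of_lt hF0 ?_
        simp at hk
        omega
      · refine Finset.sum_congr rfl fun k _ => ?_
        rw [← coeff_posGenFun_pow, add_comm]
  have hgeom : (∑ k ∈ Finset.range n, F ^ (k + 1)) * (1 - F) = F - F ^ (n + 1) := by
    have := geom_sum_mul_neg F n
    simp only [pow_succ, ← Finset.sum_mul]
    linear_combination F * this
  have : coeff n (posGenFun (fun n => ∑ k ∈ Finset.Icc 1 n, c1 f n k) * (1 - F)) =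
      coeff n ((∑ k ∈ Finset.range n, F ^ (k + 1)) * (1 - F)) := by
    rw [coeff_mul, coeff_mul]
    refine Finset.sum_congr rfl fun p hp => ?_
    rw [hcoeff p.1 (Finset.HasAntidiagonal.antidiagonal.fst_le hp)]
  rw [this, hgeom, map_sub,
    coeff_eq_zero_of_constantCoeff_eq_zero_of_lt hF0 n.lt_succ_self, sub_zero]

open PowerSeries in
lemma posGenFun_fm_mul (f : ℕ → ℕ) (m : ℕ) :
    posGenFun (fm f m) * (1 - (m : ℤ⟦X⟧) * posGenFun f) = posGenFun f := by
  induction m with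
  | zero => simp [fm]
  | succ m ih =>
    have h := posGenFun_invert (fm f m)
    rw [fm]
    push_cast
    set G := posGenFun (fun n => ∑ k ∈ Finset.Icc 1 n, c1 (fm f m) n k)
    linear_combination (1 - (m : ℤ⟦X⟧) * posGenFun f) * h + (1 + G) * ih

open PowerSeries in
/-- The expansion of `(F / (1 - r F)) ^ (d + 1)` in powers of `F`. -/
lemma coeff_pow_of_mul_one_sub_eq {R : Type*} [CommRing R] {F G : R⟦X⟧} {r : R}
    (hF : constantCoeff F = 0) (hG : G * (1 - C r * F) = F) (d n : ℕ) :
    coeff n (G ^ (d + 1)) = ∑ i ∈ Finset.Icc (d + 1) n,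
      r ^ (i - (d + 1)) * ((i - 1).choose d : R) * coeff n (F ^ i) := by
  have hs : HasSubst F := HasSubst.of_constantCoeff_zero' hF
  set P : R⟦X⟧ := rescale r (PowerSeries.mk fun n => (Nat.choose (d + n) d : R)) with hP
  have hP1 : P * (1 - C r * X) ^ (d + 1) = 1 := by
    have := congrArg (rescale r) (mk_add_choose_mul_one_sub_pow_eq_one R d)
    simpa [rescale_X] using this
  have hsub : subst F P * (1 - C r * F) ^ (d + 1) = 1 := by
    have := congrArg (substAlgHom (R := R) hs) hP1
    rw [map_mul, map_pow, map_sub, map_mul, map_one, substAlgHom_X] at this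
    have hC : substAlgHom (R := R) hs (C r) = C r := by
      rw [coe_substAlgHom, subst_C]; rfl
    rwa [hC, coe_substAlgHom] at this
  have hGpow : G ^ (d + 1) = subst F (X ^ (d + 1) * P) := by
    rw [subst_mul hs, subst_pow hs, subst_X hs]
    have h := congrArg (· ^ (d + 1)) hG
    simp only [mul_pow] at h
    linear_combination (-(G ^ (d + 1))) * hsub + (subst F P) * h
  rw [hGpow, coeff_subst' hs, finsum_eq_sum_of_support_subset (s := Finset.Icc (d + 1) n)]
  · refine Finset.sum_congr rfl fun i hi => ?_
    obtain ⟨hi1, -⟩ := Finset.mem_Icc.mp hi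
    rw [coeff_X_pow_mul', if_pos hi1, hP, coeff_rescale, coeff_mk, smul_eq_mul,
      show d + (i - (d + 1)) = i - 1 by omega]
  · intro i hi
    rw [Function.mem_support] at hi
    simp only [Finset.coe_Icc, Set.mem_Icc]
    by_contra hcon
    apply hi
    by_cases h1 : d + 1 ≤ i
    · rw [coeff_eq_zero_of_constantCoeff_eq_zero_of_lt hF (by omega), smul_zero]
    · rw [coeff_X_pow_mul', if_neg h1, zero_smul]

open PowerSeries in
lemma posGenFun_choose {a : ℕ} (ha : 1 ≤ a) :
    posGenFun (fun i => (i + a - 2).choose (a - 1)) = X * (invOneSubPow ℤ a).val := by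
  rw [invOneSubPow_val_eq_mk_sub_one_add_choose_of_pos ℤ a ha]
  ext n
  cases n with
  | zero => simp [posGenFun]
  | succ n =>
    rw [coeff_succ_X_mul]
    simp [posGenFun, show n + 1 + a - 2 = a - 1 + n by omega]

open PowerSeries in
lemma coeff_posGenFun_choose_pow {a i n : ℕ} (ha : 1 ≤ a) (hi : 1 ≤ i) (hin : i ≤ n) :
    coeff n (posGenFun (fun i => (i + a - 2).choose (a - 1)) ^ i) =
      ((n + a * i - i - 1).choose (a * i - 1) : ℤ) := by
  have hai : 0 < a * i := Nat.mul_pos ha hi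
  have hpow : invOneSubPow ℤ a ^ i = invOneSubPow ℤ (a * i) := by
    simp only [invOneSubPow_eq_inv_one_sub_pow, pow_mul]
  rw [posGenFun_choose ha, mul_pow, ← Units.val_pow_eq_pow_val, hpow,
    invOneSubPow_val_eq_mk_sub_one_add_choose_of_pos ℤ _ hai, coeff_X_pow_mul', if_pos hin,
    coeff_mk, show a * i - 1 + (n - i) = n + a * i - i - 1 by omega]

theorem stmt_8 (a m : ℕ) (ha : 1 ≤ a) (hm : 1 ≤ m) (n k : ℕ) (hk : 1 ≤ k) (hn : k ≤ n) :
    cm (fun i => (i + a - 2).choose (a - 1)) m n k =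
      ∑ i ∈ Finset.Icc k n, (m - 1) ^ (i - k) * (i - 1).choose (k - 1) * (n + a * i - i - 1).choose (a * i - 1) := by
  obtain ⟨d, rfl⟩ := Nat.exists_eq_add_of_le' hk
  have hG := posGenFun_fm_mul (fun i => (i + a - 2).choose (a - 1)) (m - 1)
  rw [← map_natCast (PowerSeries.C (R := ℤ))] at hG
  have h := coeff_pow_of_mul_one_sub_eq (constantCoeff_posGenFun _) hG d n
  rw [coeff_posGenFun_pow] at h
  rw [cm]
  zify
  rw [h]
  refine Finset.sum_congr rfl fun i hi => ?_
  obtain ⟨hi1, hi2⟩ := Finset.mem_Icc.mp hi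
  rw [coeff_posGenFun_choose_pow ha (by omega) hi2, Nat.add_sub_cancel]
end

section
/- Let $a \geq 1$ and $m \geq 1$ be integers, and let $f_0(n) = \binom{n+a-2}{a-1}$. Then for every integer $n \geq 1$, $f_m(n) = \sum_{i=1}^{n} m^{i-1} \binom{n+ai-i-1}{ai-1}$. -/
open PowerSeries in
/-- The generating function `∑_{n ≥ 1} f n X ^ n`. -/
noncomputable def positiveGenFun (f : ℕ → ℕ) : ℚ⟦X⟧ :=
  PowerSeries.mk fun n => if 0 < n then (f n : ℚ) else 0

open PowerSeries in
theorem constantCoeff_positiveGenFun (f : ℕ → ℕ) : constantCoeff (positiveGenFun f) = 0 := by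
  simp [positiveGenFun, ← coeff_zero_eq_constantCoeff_apply]

open PowerSeries in
theorem coeff_positiveGenFun_pow (f : ℕ → ℕ) (n k : ℕ) :
    coeff n (positiveGenFun f ^ k) = (c1 f n k : ℚ) := by
  have h : positiveGenFun f ^ k = ∏ _t : Fin k, positiveGenFun f := by simp
  rw [h, coeff_prod, c1, Finset.sum_filter, Nat.cast_sum]
  refine Finset.sum_bij' (fun l _ => ⇑l) (fun x _ => Finsupp.equivFunOnFinite.symm x)
    ?_ ?_ ?_ ?_ ?_
  · intro l hl
    simpa [Finset.Nat.mem_antidiagonalTuple, Finset.mem_finsuppAntidiag] using hl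
  · intro x hx
    simpa [Finset.Nat.mem_antidiagonalTuple, Finset.mem_finsuppAntidiag] using hx
  · intro l _
    ext t
    rfl
  · intro x _
    rfl
  · intro l _
    simp only [positiveGenFun, coeff_mk]
    split_ifs with hpos
    · simp [hpos]
    · push Not at hpos
      obtain ⟨t, ht⟩ := hpos
      rw [Nat.cast_zero]
      exact Finset.prod_eq_zero (Finset.mem_univ t) (by simp [Nat.le_zero.mp ht])

open PowerSeries in
/-- Expansion of the solution `H` of `H * (1 - c * F) = F` as a geometric series. -/
theorem coeff_eq_sum_of_mul_one_sub_eq {F H : ℚ⟦X⟧} (c : ℕ) (hF : constantCoeff F = 0)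
    (hH : H * (1 - (c : ℚ⟦X⟧) * F) = F) (n : ℕ) :
    coeff n H = ∑ i ∈ Finset.Icc 1 n, (c : ℚ) ^ (i - 1) * coeff n (F ^ i) := by
  have expand (N : ℕ) : H = ∑ i ∈ Finset.Icc 1 N, (c : ℚ⟦X⟧) ^ (i - 1) * F ^ i +
      (c : ℚ⟦X⟧) ^ N * F ^ N * H := by
    induction N with
    | zero => simp
    | succ N ih =>
      rw [Finset.sum_Icc_succ_top (by omega), Nat.add_sub_cancel]
      linear_combination ih + (c : ℚ⟦X⟧) ^ N * F ^ N * hH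
  have hXF : (X : ℚ⟦X⟧) ∣ F := X_dvd_iff.mpr hF
  have hXH : (X : ℚ⟦X⟧) ∣ H := by
    have : H = F * (1 + (c : ℚ⟦X⟧) * H) := by linear_combination hH
    rw [this]
    exact hXF.mul_right _
  have hrem : coeff n ((c : ℚ⟦X⟧) ^ n * F ^ n * H) = 0 := by
    refine X_pow_dvd_iff.mp ?_ n (Nat.lt_succ_self n)
    rw [pow_succ, mul_assoc]
    exact (mul_dvd_mul (pow_dvd_pow_of_dvd hXF n) hXH).mul_left _
  conv_lhs => rw [expand n]
  rw [map_add, hrem, add_zero, map_sum]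
  refine Finset.sum_congr rfl fun i _ => ?_
  rw [← Nat.cast_pow, ← Nat.cast_pow, ← nsmul_eq_mul, map_nsmul, nsmul_eq_mul]

open PowerSeries in
theorem positiveGenFun_fm_succ (f : ℕ → ℕ) (m : ℕ) :
    positiveGenFun (fm f (m + 1)) * (1 - positiveGenFun (fm f m)) =
      positiveGenFun (fm f m) := by
  set F := positiveGenFun (fm f m) with hF
  have hF0 : constantCoeff F = 0 := constantCoeff_positiveGenFun _
  have hinv : (1 - F)⁻¹ * (1 - F) = 1 := PowerSeries.inv_mul_cancel _ (by simp [hF0])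
  have key : positiveGenFun (fm f (m + 1)) = F * (1 - F)⁻¹ := by
    ext n
    rw [coeff_eq_sum_of_mul_one_sub_eq (F := F) (H := F * (1 - F)⁻¹) 1 hF0
      (by rw [Nat.cast_one, one_mul, mul_assoc, hinv, mul_one])]
    rcases Nat.eq_zero_or_pos n with rfl | hn
    · simp [positiveGenFun]
    · simp [positiveGenFun, hn, fm, hF, ← coeff_positiveGenFun_pow]
  rw [key, mul_assoc, hinv, mul_one]

open PowerSeries in
theorem positiveGenFun_fm (f : ℕ → ℕ) (m : ℕ) :
    positiveGenFun (fm f m) * (1 - (m : ℚ⟦X⟧) * positiveGenFun f) = positiveGenFun f := by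
  induction m with
  | zero => simp [fm]
  | succ m ih =>
    push_cast
    linear_combination (1 + positiveGenFun (fm f (m + 1))) * ih +
      (1 - (m : ℚ⟦X⟧) * positiveGenFun f) * positiveGenFun_fm_succ f m

open PowerSeries in
theorem positiveGenFun_choose {a : ℕ} (ha : 1 ≤ a) :
    positiveGenFun (fun i => (i + a - 2).choose (a - 1)) =
      X * (invOneSubPow ℚ a : ℚ⟦X⟧) := by
  ext n
  rw [invOneSubPow_val_eq_mk_sub_one_add_choose_of_pos _ _ ha]
  rcases n with _ | n
  · simp [positiveGenFun]
  · rw [coeff_succ_X_mul]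
    simp only [positiveGenFun, coeff_mk, Nat.succ_pos, if_true]
    congr 2
    omega

open PowerSeries in
theorem coeff_X_mul_invOneSubPow_pow {a i n : ℕ} (ha : 1 ≤ a) (hi : 1 ≤ i) (hin : i ≤ n) :
    coeff n ((X * (invOneSubPow ℚ a : ℚ⟦X⟧)) ^ i) =
      ((n + a * i - i - 1).choose (a * i - 1) : ℚ) := by
  have hpow : (invOneSubPow ℚ a) ^ i = invOneSubPow ℚ (a * i) := by
    rw [invOneSubPow_eq_inv_one_sub_pow, invOneSubPow_eq_inv_one_sub_pow, pow_mul]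
  have hai : 0 < a * i := Nat.mul_pos ha hi
  obtain ⟨d, rfl⟩ := Nat.exists_eq_add_of_le' hin
  rw [mul_pow, coeff_X_pow_mul, ← Units.val_pow_eq_pow_val, hpow,
    invOneSubPow_val_eq_mk_sub_one_add_choose_of_pos _ _ hai, coeff_mk]
  congr 2
  omega

theorem stmt_9 (a m : ℕ) (ha : 1 ≤ a) (hm : 1 ≤ m) (n : ℕ) (hn : 1 ≤ n) :
    fm (fun i => (i + a - 2).choose (a - 1)) m n =
      ∑ i ∈ Finset.Icc 1 n, m ^ (i - 1) * (n + a * i - i - 1).choose (a * i - 1) := by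
  have h := coeff_eq_sum_of_mul_one_sub_eq m (constantCoeff_positiveGenFun _)
    (positiveGenFun_fm (fun i => (i + a - 2).choose (a - 1)) m) n
  rw [positiveGenFun, PowerSeries.coeff_mk, if_pos (Nat.pos_of_ne_zero (by omega)), positiveGenFun_choose ha] at h
  have h' : (fm (fun i => (i + a - 2).choose (a - 1)) m n : ℚ) =
      ∑ i ∈ Finset.Icc 1 n,
        (m : ℚ) ^ (i - 1) * ((n + a * i - i - 1).choose (a * i - 1) : ℚ) := by
    rw [h]
    refine Finset.sum_congr rfl fun i hi => ?_
    rw [Finset.mem_Icc] at hi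
    rw [coeff_X_mul_invOneSubPow_pow ha hi.1 hi.2]
  exact_mod_cast h'
end

section
/- Let $f_0(n) = \binom{2n-2}{n-1}$. Then $c_1(n,n) = 1$ for all $n \geq 1$, and for all integers $1 \leq k < n$: $(n-k)! \cdot c_1(n,k) = 2^{n-k} \prod_{t=0}^{n-k-1} (k+2t)$. -/
open PowerSeries in
theorem PowerSeries.coeff_mk_pow_eq_sum_antidiagonalTuple {R : Type*} [CommSemiring R]
    (g : ℕ → R) (n k : ℕ) :
    coeff n (mk g ^ k) = ∑ x ∈ Finset.Nat.antidiagonalTuple k n, ∏ t, g (x t) := by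
  have h : (mk g) ^ k = ∏ _t : Fin k, mk g := by simp
  rw [h, coeff_prod]
  refine Finset.sum_equiv Finsupp.equivFunOnFinite ?_ ?_
  · intro l
    simp [Finset.Nat.mem_antidiagonalTuple, Finset.mem_finsuppAntidiag]
  · intro l _
    simp

open PowerSeries in
/-- `c1 f (m + k) k` is the `m`-th coefficient of the `k`-th power of `∑ i, f (i + 1) X ^ i`. -/
theorem c1_add_eq_coeff_pow (f : ℕ → ℕ) (m k : ℕ) :
    c1 f (m + k) k = coeff m (mk (fun i => f (i + 1)) ^ k) := by
  have hX : mk (fun i => if 0 < i then f i else 0) = X * mk (fun i => f (i + 1)) := by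
    ext n
    cases n <;> simp [coeff_succ_X_mul]
  rw [← coeff_X_pow_mul _ k m, ← mul_pow, ← hX, coeff_mk_pow_eq_sum_antidiagonalTuple, c1,
    Finset.sum_filter]
  refine Finset.sum_congr rfl fun x _ => ?_
  rw [Finset.prod_ite_zero]
  simp

/-- The generating function of the central binomial coefficients. -/
noncomputable def centralBinomSeries : PowerSeries ℕ :=
  PowerSeries.mk Nat.centralBinom

open PowerSeries in
theorem derivative_centralBinomSeries :
    d⁄dX ℕ centralBinomSeries =
      4 * (X * d⁄dX ℕ centralBinomSeries) + 2 * centralBinomSeries := by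
  ext n
  have h4 : (4 : PowerSeries ℕ) = C 4 := rfl
  have h2 : (2 : PowerSeries ℕ) = C 2 := rfl
  have h := Nat.succ_mul_centralBinom_succ n
  rw [h4, h2, map_add, coeff_C_mul, coeff_C_mul]
  cases n <;> simp [coeff_succ_X_mul, coeff_derivative, centralBinomSeries] at h ⊢ <;> linarith

open PowerSeries in
theorem derivative_centralBinomSeries_pow (k : ℕ) :
    d⁄dX ℕ (centralBinomSeries ^ k) =
      4 * (X * d⁄dX ℕ (centralBinomSeries ^ k)) + 2 * (k : PowerSeries ℕ) * centralBinomSeries ^ k := by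
  cases k with
  | zero => simp
  | succ k =>
    rw [derivative_pow, Nat.add_sub_cancel]
    conv_lhs => rw [derivative_centralBinomSeries]
    push_cast
    ring

open PowerSeries in
theorem succ_mul_coeff_centralBinomSeries_pow (m k : ℕ) :
    (m + 1) * coeff (m + 1) (centralBinomSeries ^ k) =
      2 * (k + 2 * m) * coeff m (centralBinomSeries ^ k) := by
  have h := congrArg (coeff m) (derivative_centralBinomSeries_pow k)
  have h4 : (4 : PowerSeries ℕ) = C 4 := rfl
  have h2 : (2 * k : PowerSeries ℕ) = C (2 * k) := by simp
  rw [h4, h2, map_add, coeff_C_mul, coeff_C_mul] at h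
  generalize centralBinomSeries ^ k = f at h ⊢
  cases m <;> simp [coeff_succ_X_mul, coeff_derivative] at h ⊢ <;> linarith

open PowerSeries in
theorem factorial_mul_coeff_centralBinomSeries_pow (m k : ℕ) :
    m.factorial * coeff m (centralBinomSeries ^ k) =
      2 ^ m * ∏ t ∈ Finset.range m, (k + 2 * t) := by
  induction m with
  | zero => simp [centralBinomSeries, Nat.centralBinom_zero]
  | succ m ih =>
    rw [Finset.prod_range_succ, Nat.factorial_succ, mul_right_comm,
      succ_mul_coeff_centralBinomSeries_pow, mul_assoc, mul_comm (coeff m _), ih]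
    ring

open PowerSeries in
theorem factorial_mul_c1_choose (m k : ℕ) :
    m.factorial * c1 (fun i => (2 * i - 2).choose (i - 1)) (m + k) k =
      2 ^ m * ∏ t ∈ Finset.range m, (k + 2 * t) := by
  rw [c1_add_eq_coeff_pow, ← factorial_mul_coeff_centralBinomSeries_pow]
  rfl

theorem stmt_14 :
    (∀ n : ℕ, 1 ≤ n → c1 (fun i => (2 * i - 2).choose (i - 1)) n n = 1) ∧
    (∀ n k : ℕ, 1 ≤ k → k < n →
      (n - k).factorial * c1 (fun i => (2 * i - 2).choose (i - 1)) n k =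
        2 ^ (n - k) * ∏ t ∈ Finset.range (n - k), (k + 2 * t)) := by
  refine ⟨fun n _ => ?_, fun n k _ hkn => ?_⟩
  · simpa using factorial_mul_c1_choose 0 n
  · have h := factorial_mul_c1_choose (n - k) k
    rwa [Nat.sub_add_cancel hkn.le] at h
end

section
/- Let $f_0(n) = \binom{2n-1}{n}$. Then for all integers $n \geq k \geq 1$: $n! \cdot c_1(n,k) = 2^{n-k} \sum_{i=0}^{k} (-1)^{k-i} \binom{k}{i} \prod_{t=0}^{n-1} (i+2t)$, as an identity of integers. -/
theorem coeff_pow_eq_sum_antidiagonalTuple {R : Type*} [CommSemiring R] (φ : PowerSeries R)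
    (n k : ℕ) :
    PowerSeries.coeff n (φ ^ k) =
      ∑ x ∈ Finset.Nat.antidiagonalTuple k n, ∏ t, PowerSeries.coeff (x t) φ := by
  have h : φ ^ k = ∏ _t : Fin k, φ := by simp
  rw [h, PowerSeries.coeff_prod]
  refine Finset.sum_bij' (fun l _ => ⇑l) (fun x _ => Finsupp.equivFunOnFinite.symm x)
    ?_ ?_ ?_ ?_ ?_
  · intro l hl
    simpa [Finset.Nat.mem_antidiagonalTuple] using hl
  · intro x hx
    simpa [Finset.Nat.mem_antidiagonalTuple] using hx
  · intro l _
    ext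
    simp
  · intro x _
    simp
  · intro l _
    rfl

/-- The sum `c1 f0 n k` is the coefficient of degree `n` in the `k`-th power of the generating
function of `f0` without its constant term. -/
theorem cast_c1_eq_coeff (R : Type*) [CommSemiring R] (f0 : ℕ → ℕ) (n k : ℕ) :
    (c1 f0 n k : R) =
      PowerSeries.coeff n ((PowerSeries.mk fun i => if i = 0 then (0 : R) else f0 i) ^ k) := by
  rw [coeff_pow_eq_sum_antidiagonalTuple, c1, Nat.cast_sum, Finset.sum_filter]
  refine Finset.sum_congr rfl fun x _ => ?_
  split_ifs with h
  · rw [Nat.cast_prod]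
    refine Finset.prod_congr rfl fun t _ => ?_
    rw [PowerSeries.coeff_mk, if_neg (h t).ne']
  · push Not at h
    obtain ⟨t, ht⟩ := h
    refine (Finset.prod_eq_zero (Finset.mem_univ t) ?_).symm
    rw [PowerSeries.coeff_mk, if_pos (Nat.le_zero.mp ht)]

/-- The generating function of the central binomial coefficients. -/
def centralBinomGenFun : PowerSeries ℤ :=
  PowerSeries.mk fun n => (n.centralBinom : ℤ)

theorem derivative_centralBinomGenFun :
    PowerSeries.derivative ℤ centralBinomGenFun =
      2 * centralBinomGenFun +
        4 * (PowerSeries.X * PowerSeries.derivative ℤ centralBinomGenFun) := by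
  ext n
  have h4 : (4 : PowerSeries ℤ) = PowerSeries.C 4 := by simp
  have h2 : (2 : PowerSeries ℤ) = PowerSeries.C 2 := by simp
  have h := congrArg (Nat.cast (R := ℤ)) (Nat.succ_mul_centralBinom_succ n)
  push_cast at h
  rw [map_add, h4, h2, PowerSeries.coeff_C_mul, PowerSeries.coeff_C_mul]
  cases n with
  | zero =>
    simp [centralBinomGenFun, PowerSeries.coeff_derivative]
    simpa using h
  | succ m =>
    rw [PowerSeries.coeff_succ_X_mul]
    simp only [PowerSeries.coeff_derivative, centralBinomGenFun, PowerSeries.coeff_mk]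
    push_cast at h ⊢
    linear_combination h

theorem derivative_centralBinomGenFun_pow (i : ℕ) :
    PowerSeries.derivative ℤ (centralBinomGenFun ^ i) =
      2 * (i : PowerSeries ℤ) * centralBinomGenFun ^ i +
        4 * (PowerSeries.X * PowerSeries.derivative ℤ (centralBinomGenFun ^ i)) := by
  cases i with
  | zero => simp
  | succ j =>
    rw [PowerSeries.derivative_pow, Nat.add_sub_cancel]
    linear_combination
      ((j + 1 : ℕ) : PowerSeries ℤ) * centralBinomGenFun ^ j * derivative_centralBinomGenFun

theorem succ_mul_coeff_centralBinomGenFun_pow (i n : ℕ) :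
    ((n : ℤ) + 1) * PowerSeries.coeff (n + 1) (centralBinomGenFun ^ i) =
      2 * (i + 2 * n) * PowerSeries.coeff n (centralBinomGenFun ^ i) := by
  have h4 : (4 : PowerSeries ℤ) = PowerSeries.C 4 := by simp
  have h2 : 2 * (i : PowerSeries ℤ) = PowerSeries.C (2 * (i : ℤ)) := by simp
  have h := congrArg (PowerSeries.coeff n) (derivative_centralBinomGenFun_pow i)
  rw [map_add, h4, h2, PowerSeries.coeff_C_mul, PowerSeries.coeff_C_mul] at h
  cases n with
  | zero =>
    rw [PowerSeries.coeff_zero_X_mul, PowerSeries.coeff_derivative] at h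
    push_cast at h ⊢
    linear_combination h
  | succ m =>
    rw [PowerSeries.coeff_succ_X_mul, PowerSeries.coeff_derivative,
      PowerSeries.coeff_derivative] at h
    push_cast at h ⊢
    linear_combination h

theorem factorial_mul_coeff_centralBinomGenFun_pow (i n : ℕ) :
    (n.factorial : ℤ) * PowerSeries.coeff n (centralBinomGenFun ^ i) =
      2 ^ n * ∏ t ∈ Finset.range n, ((i : ℤ) + 2 * t) := by
  induction n with
  | zero => simp [centralBinomGenFun]
  | succ n ih =>
    rw [Finset.prod_range_succ, Nat.factorial_succ]
    push_cast
    linear_combination (n.factorial : ℤ) * succ_mul_coeff_centralBinomGenFun_pow i n +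
      2 * (i + 2 * n) * ih

theorem two_mul_choose_eq_centralBinom {n : ℕ} (hn : n ≠ 0) :
    2 * (2 * n - 1).choose n = n.centralBinom := by
  obtain ⟨m, rfl⟩ := Nat.exists_eq_succ_of_ne_zero hn
  rw [Nat.centralBinom_eq_two_mul_choose, show 2 * (m + 1) - 1 = 2 * m + 1 by omega,
    Nat.succ_eq_add_one, show 2 * (m + 1) = 2 * m + 1 + 1 by ring,
    Nat.choose_succ_succ' (2 * m + 1) m, ← Nat.choose_symm_half m]
  ring

theorem two_mul_mk_choose_eq :
    2 * (PowerSeries.mk fun i => if i = 0 then (0 : ℤ) else ((2 * i - 1).choose i : ℕ)) =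
      centralBinomGenFun - 1 := by
  have h2 : (2 : PowerSeries ℤ) = PowerSeries.C 2 := by simp
  ext n
  rw [h2, PowerSeries.coeff_C_mul, map_sub, PowerSeries.coeff_one, centralBinomGenFun,
    PowerSeries.coeff_mk, PowerSeries.coeff_mk]
  split_ifs with h
  · simp [h]
  · rw [← two_mul_choose_eq_centralBinom h]
    push_cast
    ring

theorem stmt_18 (n k : ℕ) (hk : 1 ≤ k) (hn : k ≤ n) :
    (n.factorial : ℤ) * (c1 (fun i => (2 * i - 1).choose i) n k : ℤ) =
      2 ^ (n - k) * ∑ i ∈ Finset.range (k + 1),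
        (-1 : ℤ) ^ (k - i) * (k.choose i : ℤ) * ∏ t ∈ Finset.range n, ((i : ℤ) + 2 * t) := by
  have hpow : (2 : ℤ) ^ k * (c1 (fun i => (2 * i - 1).choose i) n k : ℤ) =
      ∑ i ∈ Finset.range (k + 1), (-1 : ℤ) ^ (k - i) * (k.choose i : ℤ) *
        PowerSeries.coeff n (centralBinomGenFun ^ i) := by
    have h2 : (2 : PowerSeries ℤ) = PowerSeries.C 2 := by simp
    rw [cast_c1_eq_coeff, ← PowerSeries.coeff_C_mul, map_pow, ← h2, ← mul_pow,
      two_mul_mk_choose_eq, sub_eq_add_neg, add_pow, map_sum]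
    refine Finset.sum_congr rfl fun i _ => ?_
    rw [← PowerSeries.coeff_C_mul]
    congr 1
    simp only [map_mul, map_pow, map_neg, map_one, map_natCast]
    ring
  refine mul_left_cancel₀ (pow_ne_zero k (two_ne_zero (α := ℤ))) ?_
  rw [mul_left_comm, hpow, ← mul_assoc, ← pow_add, Nat.add_sub_cancel' hn, Finset.mul_sum,
    Finset.mul_sum]
  refine Finset.sum_congr rfl fun i _ => ?_
  linear_combination (-1 : ℤ) ^ (k - i) * (k.choose i : ℤ) *
    factorial_mul_coeff_centralBinomGenFun_pow i n
end
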